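/- For every positive integer n, the number of partitions of n satisfies p(n) = (1/n!) · Σ_{k=0}^{n} (-1)^k · k! · B_{n,k}(λ₁, λ₂, …, λ_{n−k+1}), where λ_m = (−1)^j · m! if m = j(3j−1)/2 for some integer j (positive or negative), and λ_m = 0 if m is not a generalized pentagonal number. -/

import Mathlib

/-- The partial Bell polynomial `B_{n,k}(x₁, …, x_{n-k+1})`, given by
`∑ (n! / ∏ ℓᵢ!) · ∏ (xᵢ / i!)^ℓᵢ` over all tuples of nonnegative integers
`(ℓ₁, …, ℓ_{n-k+1})` with `∑ i·ℓᵢ = n` and `∑ ℓᵢ = k`. -/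
def bellPartial (n k : ℕ) (x : ℕ → ℚ) : ℚ :=
  ∑ ℓ ∈ Finset.univ.filter (fun ℓ : Fin (n - k + 1) → Fin (n + 1) =>
      (∑ i, (i.1 + 1) * (ℓ i).1) = n ∧ (∑ i, (ℓ i).1) = k),
    (n.factorial : ℚ) / (∏ i, ((ℓ i).1.factorial : ℚ)) *
      ∏ i, (x (i.1 + 1) / ((i.1 + 1).factorial : ℚ)) ^ (ℓ i).1

open PowerSeries

/-- The generating function of the partition numbers is the inverse of the pentagonal series. -/
theorem powerSeriesMk_card_partition_mul_pentagonalSeries :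
    (PowerSeries.mk fun n ↦ (Fintype.card (Nat.Partition n) : ℚ)) * pentagonalSeries ℚ = 1 := by
  open scoped PowerSeries.WithPiTopology in
  have h := Nat.Partition.hasProd_powerSeriesMk_card_restricted ℚ (fun _ ↦ True)
  have h' := h.mul (WithPiTopology.hasProd_one_sub_X_pow ℚ)
  have hcard : ∀ n, (Nat.Partition.restricted n fun _ ↦ True).card
      = Fintype.card (Nat.Partition n) := fun n ↦ by
    simp [Nat.Partition.restricted, Finset.card_univ]
  have hone : ∀ i : ℕ, (∑' j : ℕ, (X : ℚ⟦X⟧) ^ ((i + 1) * j)) * (1 - X ^ (i + 1)) = 1 := fun i ↦ by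
    simp_rw [pow_mul]
    exact WithPiTopology.tsum_pow_mul_one_sub_of_constantCoeff_eq_zero (by simp)
  simp only [if_true, hone, hcard] at h'
  exact h'.unique hasProd_one

/-- The `n`-th coefficient of a power of a power series without constant term, in terms of partial
Bell polynomials. -/
theorem coeff_X_mul_pow_eq_bellPartial {n k : ℕ} (hk : k ≤ n) (x : ℕ → ℚ) :
    coeff n ((X * PowerSeries.mk fun i ↦ x (i + 1) / ((i + 1).factorial : ℚ) : ℚ⟦X⟧) ^ k) =
      k.factorial * bellPartial n k x / n.factorial := by
  set G : ℚ⟦X⟧ := PowerSeries.mk fun i ↦ x (i + 1) / ((i + 1).factorial : ℚ) with hG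
  set T : ℚ⟦X⟧ := ∑ i : Fin (n - k + 1), monomial i.1 (x (i.1 + 1) / ((i.1 + 1).factorial : ℚ))
    with hT
  have hdvd : X ^ (n - k + 1) ∣ G ^ k - T ^ k := by
    refine dvd_trans ?_ (sub_dvd_pow_sub_pow G T k)
    rw [X_pow_dvd_iff]
    intro m hm
    simp only [hG, hT, map_sub, map_sum, coeff_mk, coeff_monomial]
    rw [Finset.sum_eq_single ⟨m, hm⟩] <;> simp +contextual [Fin.ext_iff, eq_comm]
  have hcoeff : coeff (n - k) (G ^ k) = coeff (n - k) (T ^ k) := by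
    rw [← sub_eq_zero, ← map_sub]
    exact X_pow_dvd_iff.1 hdvd _ (by omega)
  have hprod : ∀ f : Fin (n - k + 1) → ℕ,
      ∏ i, (monomial i.1 (x (i.1 + 1) / ((i.1 + 1).factorial : ℚ))) ^ f i =
        monomial (∑ i, i.1 * f i) (∏ i, (x (i.1 + 1) / ((i.1 + 1).factorial : ℚ)) ^ f i) := by
    intro f
    simp_rw [monomial_eq_C_mul_X_pow, mul_pow, Finset.prod_mul_distrib, ← pow_mul,
      Finset.prod_pow_eq_pow_sum, map_prod, map_pow]
  rw [mul_pow, coeff_X_pow_mul', if_pos hk, hcoeff, hT, Finset.sum_pow_eq_sum_piAntidiag, map_sum,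
    bellPartial, Finset.mul_sum, Finset.sum_div]
  simp_rw [hprod, ← map_natCast (C (R := ℚ)), coeff_C_mul, coeff_monomial, mul_ite, mul_zero]
  rw [← Finset.sum_filter]
  symm
  have hlt : ∀ f : Fin (n - k + 1) → ℕ, ∑ i, f i = k → ∀ i, f i < n + 1 := fun f hf i ↦ by
    have := Finset.single_le_sum (f := f) (fun _ _ ↦ Nat.zero_le _) (Finset.mem_univ i)
    omega
  refine Finset.sum_nbij' (fun ℓ i ↦ (ℓ i).1) (fun f i ↦ Fin.ofNat (n + 1) (f i)) ?_ ?_ ?_ ?_ ?_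
  · intro ℓ hℓ
    simp only [Finset.mem_filter, Finset.mem_univ, true_and, add_mul, one_mul,
      Finset.sum_add_distrib] at hℓ
    simp [hℓ.2]
    omega
  · intro f hf
    simp only [Finset.mem_filter, Finset.mem_piAntidiag] at hf
    have := hlt f hf.1.1
    have hfk : ∑ i, f i = k := hf.1.1
    simp only [Finset.mem_filter, Finset.mem_univ, true_and, add_mul, one_mul,
      Finset.sum_add_distrib, Fin.val_ofNat, Nat.mod_eq_of_lt (this _)]
    omega
  · intro ℓ _
    ext i
    simp
  · intro f hf
    simp only [Finset.mem_filter, Finset.mem_piAntidiag] at hf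
    ext i
    simp [Nat.mod_eq_of_lt (hlt f hf.1.1 i)]
  · intro ℓ hℓ
    simp only [Finset.mem_filter, Finset.mem_univ, true_and] at hℓ
    have hm : (∏ i, ((ℓ i).1.factorial : ℚ)) *
        Nat.multinomial Finset.univ (fun i ↦ (ℓ i).1) = k.factorial := by
      have := Nat.multinomial_spec Finset.univ (fun i ↦ (ℓ i).1)
      simp only [hℓ.2] at this
      exact_mod_cast this
    have h0 : (∏ i, ((ℓ i).1.factorial : ℚ)) ≠ 0 :=
      Finset.prod_ne_zero_iff.2 fun i _ ↦ by positivity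
    have hn : (n.factorial : ℚ) ≠ 0 := by positivity
    rw [← hm]
    field_simp

/-- The pentagonal series is `1 + ∑ m ≥ 1, (λ_m / m!) X ^ m`. -/
theorem pentagonalSeries_eq_one_add (lam : ℕ → ℚ)
    (hlam : ∀ (m : ℕ) (j : ℤ), 2 * (m : ℤ) = j * (3 * j - 1) →
      lam m = (-1 : ℚ) ^ j * m.factorial)
    (hlam0 : ∀ m : ℕ, (¬ ∃ j : ℤ, 2 * (m : ℤ) = j * (3 * j - 1)) → lam m = 0) :
    pentagonalSeries ℚ =
      1 + X * PowerSeries.mk fun i ↦ lam (i + 1) / ((i + 1).factorial : ℚ) := by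
  have key : ∀ m, coeff m (pentagonalSeries ℚ) = lam m / (m.factorial : ℚ) := fun m ↦ by
    by_cases h : ∃ j : ℤ, 2 * (m : ℤ) = j * (3 * j - 1)
    · obtain ⟨j, hj⟩ := h
      have hm : m = pentagonal j := by
        have := two_mul_natCast_pentagonal j
        omega
      rw [hlam m j hj, mul_div_cancel_right₀ _ (by positivity), hm,
        coeff_pentagonalSeries_pentagonal, Int.cast_negOnePow]
    · rw [hlam0 m h, zero_div]
      refine coeff_pentagonalSeries_eq_zero ℚ ?_
      rintro ⟨j, rfl⟩
      exact h ⟨j, two_mul_natCast_pentagonal j⟩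
  ext m
  rw [key]
  rcases m with _ | m
  · simp [hlam 0 0 (by simp)]
  · simp [coeff_succ_X_mul, coeff_one]

/-- For every positive integer `n`,
`p(n) = (1/n!) · ∑_{k=0}^{n} (-1)^k · k! · B_{n,k}(λ₁, …, λ_{n-k+1})`,
where `λ_m = (-1)^j · m!` if `m = j(3j-1)/2` for some `j : ℤ`, and `λ_m = 0`
if `m` is not a generalized pentagonal number. -/
theorem partition_card_eq_bell_sum (n : ℕ) (hn : 0 < n) (lam : ℕ → ℚ)
    (hlam : ∀ (m : ℕ) (j : ℤ), 2 * (m : ℤ) = j * (3 * j - 1) →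
      lam m = (-1 : ℚ) ^ j * m.factorial)
    (hlam0 : ∀ m : ℕ, (¬ ∃ j : ℤ, 2 * (m : ℤ) = j * (3 * j - 1)) → lam m = 0) :
    (Fintype.card (Nat.Partition n) : ℚ) =
      (1 / n.factorial) * ∑ k ∈ Finset.range (n + 1),
        (-1 : ℚ) ^ k * k.factorial * bellPartial n k lam := by
  set G : ℚ⟦X⟧ := PowerSeries.mk fun i ↦ lam (i + 1) / ((i + 1).factorial : ℚ) with hG
  set P : ℚ⟦X⟧ := PowerSeries.mk fun n ↦ (Fintype.card (Nat.Partition n) : ℚ) with hP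
  have hinv : P * (1 + X * G) = 1 := by
    rw [← pentagonalSeries_eq_one_add lam hlam hlam0]
    exact powerSeriesMk_card_partition_mul_pentagonalSeries
  have hgeom := mul_neg_geom_sum (-(X * G)) (n + 1)
  have hsum : P = ∑ k ∈ Finset.range (n + 1), (-(X * G)) ^ k +
      X ^ (n + 1) * ((-G) ^ (n + 1) * P) := by
    rw [← mul_assoc, ← mul_pow, mul_neg]
    linear_combination (∑ k ∈ Finset.range (n + 1), (-(X * G)) ^ k) * hinv - P * hgeom
  have hn' : (Fintype.card (Nat.Partition n) : ℚ) = coeff n P := by simp [hP]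
  rw [hn', hsum, map_add, coeff_X_pow_mul', if_neg (by omega), add_zero, map_sum, Finset.mul_sum]
  refine Finset.sum_congr rfl fun k hk ↦ ?_
  have hkn : k ≤ n := by simpa [Nat.lt_succ_iff] using hk
  rw [neg_pow, ← map_one (C (R := ℚ)), ← map_neg, ← map_pow, coeff_C_mul,
    coeff_X_mul_pow_eq_bellPartial hkn]
  ring
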